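/- Let g be a finite-dimensional Lie algebra over a field K ⊂ ℂ with decompositions g = h_1 ⊕ … ⊕ h_s = k_1 ⊕ … ⊕ k_t into indecomposable ideals. Then s = t and, after reordering, h_i ⊆ k_i + Z(g) for all i. -/

import Mathlib

/-- An ideal `a` of a Lie algebra is an indecomposable (nonzero) ideal if it is not the
direct sum of two nonzero ideals. -/
def IsIndecomposableLieIdeal (K L : Type) [Field K] [LieRing L] [LieAlgebra K L]
    (a : LieIdeal K L) : Prop :=
  a ≠ ⊥ ∧ ¬ ∃ b c : LieIdeal K L, b ≠ ⊥ ∧ c ≠ ⊥ ∧ b ⊓ c = ⊥ ∧ b ⊔ c = a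

open Module

/-- `p` is the family of projections onto the ideals of a direct sum decomposition. -/
structure IsProjectionFamily {K L ι : Type} [Field K] [LieRing L] [LieAlgebra K L] [Fintype ι]
    (h : ι → LieIdeal K L) (p : ι → End K L) : Prop where
  mem : ∀ i x, p i x ∈ h i
  apply_of_mem : ∀ {i x}, x ∈ h i → p i x = x
  sum_apply : ∀ x, ∑ i, p i x = x
  apply_lie : ∀ i (x y : L), p i ⁅x, y⁆ = ⁅x, p i y⁆
  apply_of_ne : ∀ {i j}, i ≠ j → ∀ x, p j (p i x) = 0

section

variable {K L ι κ : Type} [Field K] [LieRing L] [LieAlgebra K L]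
  {h : ι → LieIdeal K L} {k : κ → LieIdeal K L} {p : ι → End K L} {q : κ → End K L}

theorem isInternal_of_iSupIndep_of_iSup_eq_top [DecidableEq ι]
    (hindep : iSupIndep h) (hsup : ⨆ i, h i = ⊤) :
    DirectSum.IsInternal fun i => (h i).toSubmodule :=
  DirectSum.isInternal_submodule_of_iSupIndep_of_iSup_eq_top
    (LieSubmodule.iSupIndep_toSubmodule.mpr hindep)
    (by rw [← LieSubmodule.iSup_toSubmodule, hsup, LieSubmodule.top_toSubmodule])

theorem exists_isProjectionFamily [Fintype ι] (hindep : iSupIndep h) (hsup : ⨆ i, h i = ⊤) :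
    ∃ p : ι → End K L, IsProjectionFamily h p := by
  classical
  let := (isInternal_of_iSupIndep_of_iSup_eq_top hindep hsup).chooseDecomposition
  let A : ι → Submodule K L := fun i => (h i).toSubmodule
  let p : ι → End K L := fun i =>
    (A i).subtype ∘ₗ DirectSum.component K ι (fun i => A i) i ∘ₗ
      (DirectSum.decomposeLinearEquiv A).toLinearMap
  have hp : ∀ i x, p i x = DirectSum.decompose A x i := fun _ _ => rfl
  have mem : ∀ i x, p i x ∈ h i := fun i x => (DirectSum.decompose A x i).2
  have same : ∀ {i x}, x ∈ h i → p i x = x := fun {i x} hx =>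
    DirectSum.decompose_of_mem_same A hx
  have ne : ∀ {i j}, i ≠ j → ∀ {x}, x ∈ h i → p j x = 0 := fun {i j} hij {x} hx =>
    DirectSum.decompose_of_mem_ne A hx hij
  have sum : ∀ x, ∑ i, p i x = x := fun x => by
    conv_rhs => rw [← DirectSum.sum_support_decompose A x]
    refine (Finset.sum_subset (Finset.subset_univ _) fun i _ hi => ?_).symm
    simpa [hp] using hi
  refine ⟨p, mem, same, sum, fun i x y => ?_, fun hij x => ne hij (mem _ x)⟩
  conv_lhs => rw [← sum y, lie_sum, map_sum]
  rw [Finset.sum_eq_single i]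
  · exact same ((h i).lie_mem (mem i y))
  · exact fun l _ hl => ne hl ((h l).lie_mem (mem l y))
  · simp

theorem sum_finrank_eq_finrank [Fintype ι] [Module.Finite K L]
    (hindep : iSupIndep h) (hsup : ⨆ i, h i = ⊤) :
    ∑ i, finrank K (h i) = finrank K L := by
  classical
  let := (isInternal_of_iSupIndep_of_iSup_eq_top hindep hsup).chooseDecomposition
  rw [(DirectSum.decomposeLinearEquiv fun i => (h i).toSubmodule).finrank_eq,
    finrank_directSum]
  rfl

theorem IsIndecomposableLieIdeal.eq_bot_or_eq_bot {a : LieIdeal K L}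
    (ha : IsIndecomposableLieIdeal K L a) {B C : Submodule K L}
    (hB : ∀ x : L, ∀ y ∈ B, ⁅x, y⁆ ∈ B) (hC : ∀ x : L, ∀ y ∈ C, ⁅x, y⁆ ∈ C)
    (hinf : B ⊓ C = ⊥) (hsup : B ⊔ C = a.toSubmodule) : B = ⊥ ∨ C = ⊥ := by
  by_contra! hne
  refine ha.2 ⟨⟨B, fun {x y} hy => hB x y hy⟩, ⟨C, fun {x y} hy => hC x y hy⟩, ?_, ?_, ?_, ?_⟩
  · simpa [← LieSubmodule.toSubmodule_inj] using hne.1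
  · simpa [← LieSubmodule.toSubmodule_inj] using hne.2
  · simpa [← LieSubmodule.toSubmodule_inj] using hinf
  · simpa [← LieSubmodule.toSubmodule_inj] using hsup

theorem IsIndecomposableLieIdeal.finrank_eq_one {a : LieIdeal K L}
    (ha : IsIndecomposableLieIdeal K L a) (hc : a ≤ LieAlgebra.center K L) :
    finrank K a = 1 := by
  obtain ⟨x, hx, hx0⟩ : ∃ x ∈ a, x ≠ 0 := by
    by_contra! hne
    exact ha.1 ((LieSubmodule.eq_bot_iff a).mpr hne)
  have hzero : ∀ y : L, ∀ z ∈ a, ⁅y, z⁆ = 0 := fun y z hz =>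
    (LieModule.mem_maxTrivSubmodule K L L z).mp (hc hz) y
  have hle : K ∙ x ≤ a.toSubmodule := (Submodule.span_singleton_le_iff_mem _ _).mpr hx
  obtain ⟨C, hC⟩ := Submodule.exists_isCompl (K ∙ x)
  have hsup : (K ∙ x) ⊔ C ⊓ a.toSubmodule = a.toSubmodule := by
    rw [← sup_inf_assoc_of_le C hle, hC.sup_eq_top, top_inf_eq]
  rcases ha.eq_bot_or_eq_bot (fun y z hz => by simp [hzero y z (hle hz)])
    (fun y z hz => by simp [hzero y z hz.2])
    (by rw [← inf_assoc, hC.inf_eq_bot, bot_inf_eq]) hsup with hb | hb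
  · exact absurd (Submodule.span_singleton_eq_bot.mp hb) hx0
  · rw [hb, sup_bot_eq] at hsup
    change finrank K a.toSubmodule = 1
    rw [← hsup, finrank_span_singleton hx0]

theorem sum_finrank_eq_add_card [Fintype ι]
    (hindec : ∀ i, IsIndecomposableLieIdeal K L (h i))
    [DecidablePred fun i => h i ≤ LieAlgebra.center K L] :
    ∑ i, finrank K (h i) = Fintype.card {i // h i ≤ LieAlgebra.center K L} +
      ∑ i : {i // ¬ h i ≤ LieAlgebra.center K L}, finrank K (h i) := by
  rw [← Fintype.sum_subtype_add_sum_subtype fun i => h i ≤ LieAlgebra.center K L]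
  congr 1
  rw [Fintype.sum_congr _ (fun _ => 1)
    fun i : {i // h i ≤ LieAlgebra.center K L} => (hindec i).finrank_eq_one i.2]
  simp

/-- Fitting's lemma for an endomorphism of the adjoint module with values in an
indecomposable ideal. -/
theorem IsIndecomposableLieIdeal.injOn_or_pow_eq_zero [Module.Finite K L] {a : LieIdeal K L}
    (ha : IsIndecomposableLieIdeal K L a) {u : End K L}
    (hu : ∀ x y : L, u ⁅x, y⁆ = ⁅x, u y⁆) (hmem : ∀ x, u x ∈ a) :
    (∀ x ∈ a, u x = 0 → x = 0) ∨ ∃ n, u ^ n = 0 := by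
  obtain ⟨n, hn, hn1⟩ := (u.eventually_isCompl_ker_pow_range_pow.and
    (Filter.eventually_ge_atTop 1)).exists
  obtain ⟨m, rfl⟩ := Nat.exists_eq_add_of_le' hn1
  have hpow : ∀ (r : ℕ) (x y : L), (u ^ r) ⁅x, y⁆ = ⁅x, (u ^ r) y⁆ := fun r x y => by
    induction r with
    | zero => simp
    | succ r ih => rw [pow_succ', End.mul_apply, End.mul_apply, ih, hu]
  have hle : LinearMap.range (u ^ (m + 1)) ≤ a.toSubmodule := by
    rintro _ ⟨x, rfl⟩
    rw [pow_succ']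
    exact hmem _
  rcases ha.eq_bot_or_eq_bot (B := LinearMap.range (u ^ (m + 1)))
    (C := LinearMap.ker (u ^ (m + 1)) ⊓ a.toSubmodule)
    (by rintro x _ ⟨y, rfl⟩; exact ⟨⁅x, y⁆, hpow _ x y⟩)
    (fun x y hy => ⟨LinearMap.mem_ker.mpr (by rw [hpow, LinearMap.mem_ker.mp hy.1, lie_zero]),
      a.lie_mem hy.2⟩)
    (by rw [← inf_assoc, hn.symm.inf_eq_bot, bot_inf_eq])
    (by rw [← sup_inf_assoc_of_le _ hle, hn.symm.sup_eq_top, top_inf_eq]) with hb | hb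
  · exact Or.inr ⟨m + 1, LinearMap.range_eq_bot.mp hb⟩
  · refine Or.inl fun x hx hux => ?_
    have : x ∈ LinearMap.ker (u ^ (m + 1)) ⊓ a.toSubmodule :=
      ⟨LinearMap.mem_ker.mpr (by rw [pow_succ, End.mul_apply, hux, map_zero]), hx⟩
    rwa [hb, Submodule.mem_bot] at this

/-- Two endomorphisms of the adjoint module commute on brackets. -/
theorem apply_apply_lie_comm {f f' : End K L} (hf : ∀ x y : L, f ⁅x, y⁆ = ⁅x, f y⁆)
    (hf' : ∀ x y : L, f' ⁅x, y⁆ = ⁅x, f' y⁆) (x y : L) : f (f' ⁅x, y⁆) = f' (f ⁅x, y⁆) := by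
  have hleft : f ⁅x, f' y⁆ = ⁅f x, f' y⁆ := by
    rw [← lie_skew, map_neg, hf, lie_skew]
  have hleft' : f ⁅x, y⁆ = ⁅f x, y⁆ := by
    rw [← lie_skew, map_neg, hf, lie_skew]
  rw [hf', hleft, hleft', hf']

/-- The derived ideals of `h i` and `k j` overlap, expressed through the projection
`q j` onto `k j`. -/
def Meets (h : ι → LieIdeal K L) (q : κ → End K L) (i : ι) (j : κ) : Prop :=
  ∃ x ∈ h i, ∃ y : L, q j ⁅y, x⁆ ≠ 0

theorem Meets.not_le_center {i : ι} {j : κ} (hm : Meets h q i j) :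
    ¬ h i ≤ LieAlgebra.center K L := by
  obtain ⟨x, hx, y, hxy⟩ := hm
  intro hle
  exact hxy (by rw [(LieModule.mem_maxTrivSubmodule K L L x).mp (hle hx) y, map_zero])

theorem IsProjectionFamily.exists_meets [Fintype κ] (hq : IsProjectionFamily k q) {i : ι}
    (hi : ¬ h i ≤ LieAlgebra.center K L) : ∃ j, Meets h q i j := by
  by_contra! hne
  refine hi fun x hx => (LieModule.mem_maxTrivSubmodule K L L x).mpr fun y => ?_
  rw [← hq.sum_apply ⁅y, x⁆]
  refine Finset.sum_eq_zero fun j _ => ?_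
  by_contra hj
  exact hne j ⟨x, hx, y, hj⟩

variable [Fintype ι] [Fintype κ]

theorem IsProjectionFamily.apply_apply_lie (hp : IsProjectionFamily h p)
    (hq : IsProjectionFamily k q) {i : ι} {j : κ}
    {x : L} (hx : x ∈ h i) (y : L) : p i (q j ⁅y, x⁆) = q j ⁅y, x⁆ := by
  rw [apply_apply_lie_comm (hp.apply_lie i) (hq.apply_lie j),
    hp.apply_of_mem ((h i).lie_mem hx)]

theorem Meets.symm (hp : IsProjectionFamily h p) (hq : IsProjectionFamily k q) {i : ι} {j : κ}
    (hm : Meets h q i j) : Meets k p j i := by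
  obtain ⟨x, hx, y, hxy⟩ := hm
  refine ⟨q j x, hq.mem j x, y, ?_⟩
  rwa [← hq.apply_lie, hp.apply_apply_lie hq hx]

variable [Module.Finite K L]

theorem Meets.injOn (hp : IsProjectionFamily h p) (hq : IsProjectionFamily k q) {i : ι} {j : κ}
    (hm : Meets h q i j) (hi : IsIndecomposableLieIdeal K L (h i)) :
    ∀ x ∈ h i, p i (q j x) = 0 → x = 0 := by
  obtain ⟨x, hx, y, hxy⟩ := hm
  refine (hi.injOn_or_pow_eq_zero (u := p i * q j)
    (fun a b => by simp [hp.apply_lie, hq.apply_lie]) fun a => hp.mem i _).resolve_right ?_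
  rintro ⟨n, hn⟩
  have hfix : ∀ r, ((p i * q j) ^ r) (q j ⁅y, x⁆) = q j ⁅y, x⁆ := fun r => by
    induction r with
    | zero => simp
    | succ r ih =>
      rw [pow_succ', End.mul_apply, ih, End.mul_apply, hq.apply_of_mem (hq.mem j _),
        hp.apply_apply_lie hq hx]
  exact hxy (by rw [← hfix n, hn, LinearMap.zero_apply])

theorem Meets.unique (hp : IsProjectionFamily h p) (hq : IsProjectionFamily k q) {i : ι}
    {j l : κ} (hi : IsIndecomposableLieIdeal K L (h i)) (hm : Meets h q i j)
    (hm' : Meets h q i l) : j = l := by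
  by_contra hne
  obtain ⟨x, hx, y, hxy⟩ := hm'
  refine hxy (hm.injOn hp hq hi _ ?_ ?_)
  · rw [← hp.apply_apply_lie hq hx]
    exact hp.mem i _
  · rw [hq.apply_of_ne (Ne.symm hne), map_zero]

theorem Meets.le_sup_center (hp : IsProjectionFamily h p) (hq : IsProjectionFamily k q) {i : ι}
    {j : κ} (hi : IsIndecomposableLieIdeal K L (h i)) (hm : Meets h q i j) :
    h i ≤ k j ⊔ LieAlgebra.center K L := by
  intro x hx
  rw [← hq.sum_apply x]
  refine sum_mem fun l _ => ?_
  rcases eq_or_ne j l with rfl | hne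
  · exact (le_sup_left : k j ≤ _) (hq.mem j x)
  · refine (le_sup_right : LieAlgebra.center K L ≤ _)
      ((LieModule.mem_maxTrivSubmodule K L L _).mpr fun y => ?_)
    by_contra hy
    exact hne (hm.unique hp hq hi ⟨x, hx, y, by rwa [hq.apply_lie]⟩)

theorem Meets.finrank_le (hp : IsProjectionFamily h p) (hq : IsProjectionFamily k q) {i : ι}
    {j : κ} (hi : IsIndecomposableLieIdeal K L (h i)) (hm : Meets h q i j) :
    finrank K (h i) ≤ finrank K (k j) := by
  let f : (h i).toSubmodule →ₗ[K] (k j).toSubmodule :=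
    ((q j).domRestrict (h i).toSubmodule).codRestrict _ fun x => hq.mem j x
  refine LinearMap.finrank_le_finrank_of_injective (f := f)
    ((injective_iff_map_eq_zero f).mpr fun x hx => ?_)
  have hx' : q j x = 0 := congrArg Subtype.val hx
  exact Subtype.ext (hm.injOn hp hq hi x x.2 (by rw [hx', map_zero]))

theorem Meets.finrank_eq (hp : IsProjectionFamily h p) (hq : IsProjectionFamily k q) {i : ι}
    {j : κ} (hi : IsIndecomposableLieIdeal K L (h i)) (hj : IsIndecomposableLieIdeal K L (k j))
    (hm : Meets h q i j) : finrank K (h i) = finrank K (k j) :=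
  le_antisymm (hm.finrank_le hp hq hi) ((hm.symm hp hq).finrank_le hq hp hj)

/-- The non-central summands of two decompositions into indecomposable ideals correspond to each
other. -/
theorem exists_equiv_not_le_center
    (hp : IsProjectionFamily h p) (hq : IsProjectionFamily k q)
    (hindec : ∀ i, IsIndecomposableLieIdeal K L (h i))
    (kindec : ∀ j, IsIndecomposableLieIdeal K L (k j)) :
    ∃ e : {i // ¬ h i ≤ LieAlgebra.center K L} ≃ {j // ¬ k j ≤ LieAlgebra.center K L},
      ∀ i : {i // ¬ h i ≤ LieAlgebra.center K L}, Meets h q i (e i) := by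
  choose f hf using fun i : {i // ¬ h i ≤ LieAlgebra.center K L} => hq.exists_meets i.2
  choose f' hf' using fun j : {j // ¬ k j ≤ LieAlgebra.center K L} => hp.exists_meets j.2
  exact ⟨{
    toFun := fun i => ⟨f i, ((hf i).symm hp hq).not_le_center⟩
    invFun := fun j => ⟨f' j, ((hf' j).symm hq hp).not_le_center⟩
    left_inv := fun i => Subtype.ext ((hf' _).unique hq hp (kindec _) ((hf i).symm hp hq))
    right_inv := fun j => Subtype.ext ((hf _).unique hp hq (hindec _) ((hf' j).symm hq hp)) }, hf⟩

end

/-- Fisher–Gray–Hydon: if a finite-dimensional Lie algebra `g` over a field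
`K ⊆ ℂ` has two decompositions `g = h₁ ⊕ … ⊕ h_s = k₁ ⊕ … ⊕ k_t` into indecomposable
ideals, then `s = t` and, after a reordering, `h i ⊆ k i + Z(g)` for all `i`. -/
theorem fisher_gray_hydon_uniqueness
    (K : Subfield ℂ) (g : Type) [LieRing g] [LieAlgebra K g] [Module.Finite K g]
    (s t : ℕ)
    (h : Fin s → LieIdeal K g) (k : Fin t → LieIdeal K g)
    (hindep : iSupIndep h) (hsup : ⨆ i, h i = ⊤)
    (kindep : iSupIndep k) (ksup : ⨆ j, k j = ⊤)
    (hindec : ∀ i, IsIndecomposableLieIdeal K g (h i))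
    (kindec : ∀ j, IsIndecomposableLieIdeal K g (k j)) :
    s = t ∧ ∃ e : Fin s ≃ Fin t, ∀ i : Fin s,
      h i ≤ k (e i) ⊔ LieAlgebra.center K g := by
  classical
  obtain ⟨p, hp⟩ := exists_isProjectionFamily hindep hsup
  obtain ⟨q, hq⟩ := exists_isProjectionFamily kindep ksup
  obtain ⟨e, he⟩ := exists_equiv_not_le_center hp hq hindec kindec
  have hsum : ∑ i : {i // ¬ h i ≤ LieAlgebra.center K g}, Module.finrank K (h i) =
      ∑ j : {j // ¬ k j ≤ LieAlgebra.center K g}, Module.finrank K (k j) :=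
    Fintype.sum_equiv e _ _ fun i => (he i).finrank_eq hp hq (hindec _) (kindec _)
  have hcard : Fintype.card {i // h i ≤ LieAlgebra.center K g} =
      Fintype.card {j // k j ≤ LieAlgebra.center K g} := by
    have hdim := (sum_finrank_eq_finrank hindep hsup).trans
      (sum_finrank_eq_finrank kindep ksup).symm
    rw [sum_finrank_eq_add_card hindec, sum_finrank_eq_add_card kindec, hsum] at hdim
    exact Nat.add_right_cancel hdim
  let E : Fin s ≃ Fin t := (Equiv.sumCompl _).symm.trans
    (((Fintype.equivOfCardEq hcard).sumCongr e).trans (Equiv.sumCompl _))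
  refine ⟨by simpa using Fintype.card_congr E, E, fun i => ?_⟩
  by_cases hi : h i ≤ LieAlgebra.center K g
  · exact hi.trans le_sup_right
  · let i' : {i // ¬ h i ≤ LieAlgebra.center K g} := ⟨i, hi⟩
    have hE : E i = e i' := by
      simp [E, i', Equiv.sumCompl_symm_apply_of_neg (p := fun i => h i ≤ LieAlgebra.center K g) hi]
    rw [hE]
    exact (he i').le_sup_center hp hq (hindec i)
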